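/- arXiv:1806.08048 — 3 statements merged into one kernel-verified Lean document; each statement's English description precedes it below -/
import Mathlib

section
/- Let n ≥ 1, s ∈ (0,1), R > 0, and let g : ℝⁿ → ℝ be a bounded measurable function. For x in the open ball B(0,R) define w(x) = ∫_{{y : ‖y‖ > R}} g(y) · ((R² − ‖x‖²)/(‖y‖² − R²))^s · ‖x − y‖^{−n} dy. Then for every x with ‖x‖ < R the integral converges absolutely, and the function w is infinitely differentiable on the open ball B(0, R/2). -/
open MeasureTheory Metric Set

/-- Smooth functions off the origin, homogeneous of degree `-a`, are controlled by `‖y‖ ^ (-n)`. -/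
lemma homog_bound {E F : Type} [NormedAddCommGroup E] [InnerProductSpace ℝ E]
    [FiniteDimensional ℝ E] [NormedAddCommGroup F] [NormedSpace ℝ F]
    (n : ℕ) (R : ℝ) (hR : 0 < R) (ψ : E → F) (a : ℕ) (ha : n ≤ a)
    (hψ : ContinuousOn ψ {0}ᶜ)
    (hom : ∀ (t : ℝ) (z : E), 0 < t → z ≠ 0 → ψ (t • z) = (t ^ a)⁻¹ • ψ z) :
    ∃ C : ℝ, ∀ x ∈ ball (0 : E) (R / 2), ∀ y : E, R < ‖y‖ →
      ‖ψ (x - y)‖ ≤ C * (‖y‖ ^ n)⁻¹ := by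
  obtain ⟨C, hC⟩ := (isCompact_sphere (0 : E) 1).exists_bound_of_continuousOn
    (hψ.mono (fun z hz => by
      have h1 : ‖z‖ = 1 := by simpa using hz
      intro h0
      have h2 : z = 0 := by simpa using h0
      rw [h2] at h1
      simp at h1))
  refine ⟨|C| * (R ^ (a - n) / 2 ^ a)⁻¹, fun x hx y hy => ?_⟩
  have hx' : ‖x‖ < R / 2 := by simpa using hx
  have hz : ‖y‖ / 2 ≤ ‖x - y‖ := by
    have := norm_sub_norm_le y x
    rw [norm_sub_rev] at this
    linarith
  have hypos : 0 < ‖y‖ := hR.trans hy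
  have hzpos : 0 < ‖x - y‖ := by linarith
  have hz0 : x - y ≠ 0 := norm_pos_iff.1 hzpos
  have e : ψ (x - y) = (‖x - y‖ ^ a)⁻¹ • ψ (‖x - y‖⁻¹ • (x - y)) := by
    rw [← hom _ _ hzpos (by simp [hz0, hzpos.ne']), smul_smul, mul_inv_cancel₀ hzpos.ne', one_smul]
  have hb : ‖ψ (‖x - y‖⁻¹ • (x - y))‖ ≤ |C| :=
    (hC _ (by simp [norm_smul, hzpos.ne'])).trans (le_abs_self C)
  rw [e, norm_smul, mul_comm]
  have h3 : ‖(‖x - y‖ ^ a)⁻¹‖ = (‖x - y‖ ^ a)⁻¹ := by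
    rw [Real.norm_eq_abs, abs_of_nonneg (by positivity)]
  rw [h3, mul_assoc, ← mul_inv]
  refine mul_le_mul hb ?_ (by positivity) (abs_nonneg _)
  refine inv_anti₀ (by positivity) ?_
  calc R ^ (a - n) / 2 ^ a * ‖y‖ ^ n ≤ ‖y‖ ^ (a - n) / 2 ^ a * ‖y‖ ^ n := by gcongr
    _ = (‖y‖ / 2) ^ a := by
      rw [div_pow, div_mul_eq_mul_div, ← pow_add, Nat.sub_add_cancel ha]
    _ ≤ ‖x - y‖ ^ a := by gcongr

lemma homog_fderiv {E F : Type} [NormedAddCommGroup E] [NormedSpace ℝ E]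
    [NormedAddCommGroup F] [NormedSpace ℝ F] (ψ : E → F) (a : ℕ)
    (hom : ∀ (t : ℝ) (z : E), 0 < t → z ≠ 0 → ψ (t • z) = (t ^ a)⁻¹ • ψ z)
    (t : ℝ) (z : E) (ht : 0 < t) (hz : z ≠ 0) :
    fderiv ℝ ψ (t • z) = (t ^ (a + 1))⁻¹ • fderiv ℝ ψ z := by
  have h1 : (fun w => ψ (t • w)) =ᶠ[nhds z] fun w => (t ^ a)⁻¹ • ψ w := by
    filter_upwards [isOpen_compl_singleton.mem_nhds hz] with w hw
    exact hom t w ht hw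
  have h2 := h1.fderiv_eq (𝕜 := ℝ)
  have h3 : fderiv ℝ (fun w => (t ^ a)⁻¹ • ψ w) z = (t ^ a)⁻¹ • fderiv ℝ ψ z :=
    congrFun (fderiv_const_smul_field (𝕜 := ℝ) (f := ψ) ((t ^ a)⁻¹)) z
  rw [fderiv_comp_smul, h3] at h2
  have h4 : fderiv ℝ ψ (t • z) = t⁻¹ • (t • fderiv ℝ ψ (t • z)) := by
    rw [smul_smul, inv_mul_cancel₀ ht.ne', one_smul]
  rw [h4, h2, smul_smul, pow_succ, mul_inv, mul_comm]

lemma key {E : Type} [NormedAddCommGroup E] [InnerProductSpace ℝ E]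
    [FiniteDimensional ℝ E] [MeasurableSpace E] [BorelSpace E] (μ : Measure E)
    (n : ℕ) (R : ℝ) (hR : 0 < R) (h : E → ℝ) (hh : Measurable h)
    (hint : IntegrableOn (fun y => h y * (‖y‖ ^ n)⁻¹) {y | R < ‖y‖} μ) (k : ℕ) :
    ∀ (F : Type) [NormedAddCommGroup F] [NormedSpace ℝ F] [CompleteSpace F]
      (ψ : E → F) (a : ℕ), n ≤ a → ContDiffOn ℝ (⊤ : ℕ∞) ψ {0}ᶜ →
    (∀ (t : ℝ) (z : E), 0 < t → z ≠ 0 → ψ (t • z) = (t ^ a)⁻¹ • ψ z) →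
    ContDiffOn ℝ k (fun x => ∫ y in {y | R < ‖y‖}, h y • ψ (x - y) ∂μ) (ball 0 (R / 2)) := by
  have hS : MeasurableSet {y : E | R < ‖y‖} := measurableSet_lt measurable_const measurable_norm
  have hne : ∀ x ∈ ball (0 : E) (R / 2), ∀ y : E, R < ‖y‖ → x - y ∈ ({0}ᶜ : Set E) := by
    intro x hx y hy h0
    have hx' : ‖x‖ < R / 2 := by simpa using hx
    have h1 : x = y := sub_eq_zero.1 h0
    rw [h1] at hx'
    linarith
  have meas : ∀ (F : Type) [NormedAddCommGroup F] [NormedSpace ℝ F] (ψ : E → F),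
      ContinuousOn ψ {0}ᶜ → ∀ x ∈ ball (0 : E) (R / 2),
      AEStronglyMeasurable (fun y => h y • ψ (x - y)) (μ.restrict {y | R < ‖y‖}) := by
    intro F _ _ ψ hψ x hx
    refine hh.aestronglyMeasurable.smul (ContinuousOn.aestronglyMeasurable ?_ hS)
    exact hψ.comp (by fun_prop) (fun y hy => hne x hx y hy)
  have bd : ∀ (F : Type) [NormedAddCommGroup F] [NormedSpace ℝ F] (ψ : E → F) (C : ℝ),
      (∀ x ∈ ball (0 : E) (R / 2), ∀ y : E, R < ‖y‖ → ‖ψ (x - y)‖ ≤ C * (‖y‖ ^ n)⁻¹) →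
      ∀ᵐ y ∂(μ.restrict {y | R < ‖y‖}), ∀ x ∈ ball (0 : E) (R / 2),
        ‖h y • ψ (x - y)‖ ≤ C * ‖h y * (‖y‖ ^ n)⁻¹‖ := by
    intro F _ _ ψ C hC
    filter_upwards [ae_restrict_mem hS] with y hy x hx
    rw [norm_smul, norm_mul, Real.norm_of_nonneg (r := (‖y‖ ^ n)⁻¹) (by positivity)]
    calc _ ≤ ‖h y‖ * (C * (‖y‖ ^ n)⁻¹) := by gcongr; exact hC x hx y hy
      _ = _ := by ring
  have ibd : ∀ C : ℝ, Integrable (fun y => C * ‖h y * (‖y‖ ^ n)⁻¹‖)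
      (μ.restrict {y | R < ‖y‖}) := fun C => hint.norm.const_mul C
  induction k with
  | zero =>
    intro F _ _ _ ψ a ha hψ hom
    obtain ⟨C, hC⟩ := homog_bound n R hR ψ a ha hψ.continuousOn hom
    rw [Nat.cast_zero, contDiffOn_zero]
    refine continuousOn_of_dominated (meas F ψ hψ.continuousOn) ?_ (ibd C) ?_
    · intro x hx
      filter_upwards [bd F ψ C hC] with y hy using hy x hx
    · filter_upwards [ae_restrict_mem hS] with y hy
      exact (hψ.continuousOn.comp (by fun_prop) (fun x hx => hne x hx y hy)).const_smul (h y)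
  | succ k ih =>
    intro F _ _ _ ψ a ha hψ hom
    obtain ⟨C, hC⟩ := homog_bound n R hR ψ a ha hψ.continuousOn hom
    have hψ' : ContDiffOn ℝ (⊤ : ℕ∞) (fderiv ℝ ψ) {0}ᶜ :=
      hψ.fderiv_of_isOpen isOpen_compl_singleton (by simp)
    have hom' := homog_fderiv ψ a hom
    obtain ⟨C', hC'⟩ := homog_bound n R hR (fderiv ℝ ψ) (a + 1) (by omega) hψ'.continuousOn hom'
    have hd : ∀ x ∈ ball (0 : E) (R / 2),
        HasFDerivAt (fun x => ∫ y in {y | R < ‖y‖}, h y • ψ (x - y) ∂μ)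
          (∫ y in {y | R < ‖y‖}, h y • fderiv ℝ ψ (x - y) ∂μ) x := by
      intro x hx
      have m1 := meas (E →L[ℝ] F) (fderiv ℝ ψ) hψ'.continuousOn x hx
      have b1 := bd (E →L[ℝ] F) (fderiv ℝ ψ) C' hC'
      refine hasFDerivAt_integral_of_dominated_of_fderiv_le (𝕜 := ℝ)
        (F := fun x y => h y • ψ (x - y))
        (F' := fun x y => h y • fderiv ℝ ψ (x - y)) (isOpen_ball.mem_nhds hx) ?_ ?_
        m1 b1 (ibd C') ?_
      · filter_upwards [isOpen_ball.mem_nhds hx] with x' hx'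
        exact meas F ψ hψ.continuousOn x' hx'
      · refine (ibd C).mono' (meas F ψ hψ.continuousOn x hx) ?_
        filter_upwards [bd F ψ C hC] with y hy using hy x hx
      · filter_upwards [ae_restrict_mem hS] with y hy x' hx'
        have h1 : DifferentiableAt ℝ ψ (x' - y) :=
          (hψ.contDiffAt (isOpen_compl_singleton.mem_nhds (hne x' hx' y hy))).differentiableAt
            (by simp)
        exact ((hasFDerivAt_comp_sub y).2 h1.hasFDerivAt).const_smul (h y)
    rw [Nat.cast_succ, contDiffOn_succ_iff_fderiv_of_isOpen isOpen_ball]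
    refine ⟨fun x hx => (hd x hx).differentiableAt.differentiableWithinAt, by simp, ?_⟩
    exact (ih _ (fderiv ℝ ψ) (a + 1) (by omega) hψ' hom').congr fun x hx => (hd x hx).fderiv

lemma radial_one (s R : ℝ) (hs : s ∈ Ioo (0 : ℝ) 1) (hR : 0 < R) :
    IntegrableOn (fun r : ℝ => r⁻¹ * (r ^ 2 - R ^ 2) ^ (-s)) (Ioi R) := by
  obtain ⟨hs0, hs1⟩ := hs
  have hm : Measurable (fun r : ℝ => r⁻¹ * (r ^ 2 - R ^ 2) ^ (-s)) := by fun_prop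
  rw [← Ioc_union_Ioi_eq_Ioi (show R ≤ 2 * R by linarith)]
  refine IntegrableOn.union ?_ ?_
  · have h1 : IntegrableOn (fun r : ℝ => (r - R) ^ (-s)) (Ioc R (2 * R)) := by
      have h2 := (intervalIntegral.intervalIntegrable_rpow' (r := -s) (a := 0) (b := R)
        (by linarith)).comp_sub_right R
      rw [intervalIntegrable_iff_integrableOn_Ioc_of_le (by linarith)] at h2
      rwa [zero_add, ← two_mul] at h2
    refine (h1.const_mul (R⁻¹ * R ^ (-s))).mono' hm.aestronglyMeasurable ?_
    filter_upwards [ae_restrict_mem measurableSet_Ioc] with r hr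
    have hr1 : 0 < r - R := by linarith [hr.1]
    have hr0 : 0 < r := by linarith
    have e : r ^ 2 - R ^ 2 = (r + R) * (r - R) := by ring
    rw [e, Real.mul_rpow (by linarith) hr1.le, Real.norm_of_nonneg (by positivity), ← mul_assoc]
    have h3 : (r + R) ^ (-s) ≤ R ^ (-s) :=
      Real.rpow_le_rpow_of_nonpos hR (by linarith) (by linarith)
    have h4 : r⁻¹ ≤ R⁻¹ := inv_anti₀ hR (by linarith)
    gcongr
  · have h1 : IntegrableOn (fun r : ℝ => r ^ (-1 - 2 * s)) (Ioi (2 * R)) :=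
      integrableOn_Ioi_rpow_of_lt (by linarith) (by linarith)
    refine (h1.const_mul ((1 / 2) ^ (-s))).mono' hm.aestronglyMeasurable ?_
    filter_upwards [ae_restrict_mem measurableSet_Ioi] with r hr
    have hr' : 2 * R < r := hr
    have hr0 : 0 < r := by linarith
    have hq : 1 / 2 * r ^ 2 ≤ r ^ 2 - R ^ 2 := by nlinarith
    have hq0 : 0 < 1 / 2 * r ^ 2 := by positivity
    have hq1 : 0 < r ^ 2 - R ^ 2 := by linarith
    rw [Real.norm_of_nonneg (by positivity)]
    have h3 : (r ^ 2 - R ^ 2) ^ (-s) ≤ (1 / 2 * r ^ 2) ^ (-s) :=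
      Real.rpow_le_rpow_of_nonpos hq0 hq (by linarith)
    have h5 : (r ^ 2) ^ (-s) = r ^ (-2 * s) := by
      rw [← Real.rpow_natCast, ← Real.rpow_mul hr0.le]
      congr 1
      push_cast
      ring
    rw [Real.mul_rpow (by norm_num) (by positivity), h5] at h3
    have h6 : r ^ (-1 - 2 * s) = r⁻¹ * r ^ (-2 * s) := by
      rw [← Real.rpow_neg_one, ← Real.rpow_add hr0]
      congr 1
      ring
    calc _ ≤ r⁻¹ * ((1 / 2) ^ (-s) * r ^ (-2 * s)) := by gcongr
      _ = _ := by rw [h6]; ring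

lemma radial (n : ℕ) (hn : 1 ≤ n) (s R : ℝ) (hs : s ∈ Ioo (0 : ℝ) 1) (hR : 0 < R) :
    IntegrableOn (fun y : EuclideanSpace ℝ (Fin n) => (‖y‖ ^ 2 - R ^ 2) ^ (-s) * (‖y‖ ^ n)⁻¹)
      {y | R < ‖y‖} volume := by
  have hS : MeasurableSet {y : EuclideanSpace ℝ (Fin n) | R < ‖y‖} :=
    measurableSet_lt measurable_const measurable_norm
  have : Nonempty (Fin n) := ⟨⟨0, hn⟩⟩
  have : Nontrivial (EuclideanSpace ℝ (Fin n)) := by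
    apply Module.nontrivial_of_finrank_pos (R := ℝ)
    simp
    omega
  rw [← integrable_indicator_iff hS]
  have e : ({y : EuclideanSpace ℝ (Fin n) | R < ‖y‖}.indicator
      fun y => (‖y‖ ^ 2 - R ^ 2) ^ (-s) * (‖y‖ ^ n)⁻¹) =
      fun y => (Ioi R).indicator (fun r : ℝ => (r ^ 2 - R ^ 2) ^ (-s) * (r ^ n)⁻¹) ‖y‖ := by
    ext y
    simp [indicator]
  rw [e, integrable_fun_norm_addHaar]
  have h1 := (integrable_indicator_iff measurableSet_Ioi).2 (radial_one s R hs hR)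
  refine (h1.integrableOn (s := Ioi 0)).congr_fun ?_ measurableSet_Ioi
  intro r hr
  have hr0 : (0 : ℝ) < r := hr
  by_cases hrR : R < r
  · obtain ⟨m, rfl⟩ : ∃ m, n = m + 1 := ⟨n - 1, by omega⟩
    simp [indicator, hrR]
    field_simp
    ring
  · simp [indicator, hrR]

theorem stmt0 (n : ℕ) (hn : 1 ≤ n) (s R : ℝ) (hs : s ∈ Set.Ioo (0:ℝ) 1) (hR : 0 < R)
    (g : EuclideanSpace ℝ (Fin n) → ℝ) (hgm : Measurable g)
    (M : ℝ) (hgb : ∀ y, |g y| ≤ M) :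
    (∀ x : EuclideanSpace ℝ (Fin n), ‖x‖ < R →
      MeasureTheory.IntegrableOn
        (fun y => g y * ((R ^ 2 - ‖x‖ ^ 2) / (‖y‖ ^ 2 - R ^ 2)) ^ s * ‖x - y‖ ^ (-(n : ℝ)))
        {y | R < ‖y‖} volume) ∧
    ContDiffOn ℝ (⊤ : ℕ∞)
      (fun x => ∫ y in {y : EuclideanSpace ℝ (Fin n) | R < ‖y‖},
        g y * ((R ^ 2 - ‖x‖ ^ 2) / (‖y‖ ^ 2 - R ^ 2)) ^ s * ‖x - y‖ ^ (-(n : ℝ)))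
      (Metric.ball 0 (R / 2)) := by
  have hS : MeasurableSet {y : EuclideanSpace ℝ (Fin n) | R < ‖y‖} :=
    measurableSet_lt measurable_const measurable_norm
  set h : EuclideanSpace ℝ (Fin n) → ℝ := fun y => g y * (‖y‖ ^ 2 - R ^ 2) ^ (-s) with hh
  have hm : Measurable h := by fun_prop
  have hint : IntegrableOn (fun y => h y * (‖y‖ ^ n)⁻¹) {y | R < ‖y‖} volume := by
    refine ((radial n hn s R hs hR).const_mul M).mono' (by fun_prop) ?_
    filter_upwards [ae_restrict_mem hS] with y hy
    have hy' : R < ‖y‖ := hy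
    have h1 : 0 < ‖y‖ ^ 2 - R ^ 2 := by nlinarith
    rw [hh, mul_assoc, norm_mul,
      Real.norm_of_nonneg (r := (‖y‖ ^ 2 - R ^ 2) ^ (-s) * (‖y‖ ^ n)⁻¹) (by positivity)]
    gcongr
    exact hgb y
  have fac : ∀ x : EuclideanSpace ℝ (Fin n), ‖x‖ < R → ∀ y : EuclideanSpace ℝ (Fin n), R < ‖y‖ →
      g y * ((R ^ 2 - ‖x‖ ^ 2) / (‖y‖ ^ 2 - R ^ 2)) ^ s * ‖x - y‖ ^ (-(n : ℝ)) =
      (R ^ 2 - ‖x‖ ^ 2) ^ s * (h y * (‖x - y‖ ^ n)⁻¹) := by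
    intro x hx y hy
    have h1 : 0 < ‖y‖ ^ 2 - R ^ 2 := by nlinarith
    have h2 : 0 < R ^ 2 - ‖x‖ ^ 2 := by nlinarith [norm_nonneg x]
    rw [Real.div_rpow h2.le h1.le, Real.rpow_neg (norm_nonneg _), Real.rpow_natCast, hh]
    simp only
    rw [Real.rpow_neg h1.le]
    ring
  constructor
  · intro x hx
    have hint2 : IntegrableOn (fun y => (R ^ 2 - ‖x‖ ^ 2) ^ s * (h y * (‖x - y‖ ^ n)⁻¹))
        {y | R < ‖y‖} volume := by
      refine Integrable.const_mul ?_ _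
      have hc : 0 < 1 - ‖x‖ / R := by
        rw [sub_pos, div_lt_one hR]
        exact hx
      refine (hint.norm.const_mul (((1 - ‖x‖ / R) ^ n)⁻¹)).mono' (by fun_prop) ?_
      filter_upwards [ae_restrict_mem hS] with y hy
      have hy' : R < ‖y‖ := hy
      have hy0 : 0 < ‖y‖ := hR.trans hy'
      have h1 : (1 - ‖x‖ / R) * ‖y‖ ≤ ‖x - y‖ := by
        have h2 := norm_sub_norm_le y x
        rw [norm_sub_rev] at h2
        have h3 : ‖x‖ ≤ ‖x‖ / R * ‖y‖ := by
          rw [div_mul_eq_mul_div, le_div_iff₀ hR]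
          gcongr
        linarith
      rw [norm_mul (h y), norm_mul (h y), Real.norm_of_nonneg (r := (‖y‖ ^ n)⁻¹) (by positivity),
        Real.norm_of_nonneg (r := (‖x - y‖ ^ n)⁻¹) (by positivity)]
      calc _ ≤ ‖h y‖ * (((1 - ‖x‖ / R) * ‖y‖) ^ n)⁻¹ := by gcongr
        _ = _ := by rw [mul_pow, mul_inv]; ring
    exact hint2.congr_fun (fun y hy => (fac x hx y hy).symm) hS
  · have hψ : ContDiffOn ℝ (⊤ : ℕ∞) (fun z : EuclideanSpace ℝ (Fin n) => (‖z‖ ^ n)⁻¹) {0}ᶜ := by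
      intro z hz
      have hz0 : z ≠ 0 := hz
      exact (((contDiffAt_norm ℝ hz0).pow n).inv (by positivity)).contDiffWithinAt
    have h1 : ContDiffOn ℝ (⊤ : ℕ∞) (fun x => ∫ y in {y : EuclideanSpace ℝ (Fin n) | R < ‖y‖},
        h y • (‖x - y‖ ^ n)⁻¹) (ball 0 (R / 2)) := by
      rw [contDiffOn_infty]
      intro k
      refine key volume n R hR h hm hint k ℝ (fun z => (‖z‖ ^ n)⁻¹) n le_rfl hψ ?_
      intro t z ht hz
      rw [norm_smul, Real.norm_of_nonneg ht.le, mul_pow, mul_inv, smul_eq_mul]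
    have h2 : ContDiffOn ℝ (⊤ : ℕ∞) (fun x : EuclideanSpace ℝ (Fin n) => (R ^ 2 - ‖x‖ ^ 2) ^ s)
        (ball 0 (R / 2)) := by
      refine ContDiffOn.rpow_const_of_ne (contDiff_const.sub (contDiff_norm_sq ℝ)).contDiffOn ?_
      intro x hx
      have hx' : ‖x‖ < R / 2 := by simpa using hx
      have : 0 < R ^ 2 - ‖x‖ ^ 2 := by nlinarith [norm_nonneg x]
      exact this.ne'
    refine (h2.mul h1).congr fun x hx => ?_
    have hx' : ‖x‖ < R := by
      have : ‖x‖ < R / 2 := by simpa using hx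
      linarith
    simp only [smul_eq_mul]
    rw [← integral_const_mul]
    exact setIntegral_congr_fun hS fun y hy => fac x hx' y hy
end

section
/- Let n ≥ 1, let Ω ⊂ ℝⁿ be a nonempty bounded open set, let s ∈ (0,1), ε ∈ (0, s/2) and K ≥ 0. Suppose g : Ω → ℝⁿ is measurable and satisfies (i) ‖g(x)‖ ≤ K δ(x)^{s−1} for all x ∈ Ω, and (ii) ‖g(x) − g(y)‖ ≤ K ‖x − y‖^s / δ(x,y) for all x, y ∈ Ω, and suppose A := ∫_Ω δ(x)^{2ε−1} dx < ∞. Then there exists a constant C depending only on n such that ∫_Ω ‖g(x)‖² δ(x)^{1−2ε} dx + ∬_{Ω×Ω} ‖g(x) − g(y)‖² δ(x,y)^{1−2ε} ‖x − y‖^{−(n+2s−4ε)} dx dy + ∫_Ω ‖g(x)‖² ( ∫_{Ωᶜ} δ(x,y)^{1−2ε} ‖x − y‖^{−(n+2s−4ε)} dy ) dx ≤ C · (1 + diam Ω)² · K² · A · (1/ε + 1/(s − 2ε)). -/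
open MeasureTheory Metric Set

/-- Surface constant. -/
noncomputable def sphC (n : ℕ) : ℝ := n * (volume : Measure (EuclideanSpace ℝ (Fin n))).real (ball 0 1)

lemma sphC_nonneg (n : ℕ) : 0 ≤ sphC n := by unfold sphC; positivity

lemma radial_lintegral (n : ℕ) (hn : 1 ≤ n) (f : ℝ → ℝ) (hf : ∀ r, 0 ≤ r → 0 ≤ f r) (h : ℝ → ℝ)
    (hfh : ∀ y ∈ Ioi (0:ℝ), y ^ (n - 1) * f y = h y) (hh : IntegrableOn h (Ioi 0)) :
    ∫⁻ x : EuclideanSpace ℝ (Fin n), ENNReal.ofReal (f ‖x‖) =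
      ENNReal.ofReal (sphC n * ∫ y in Ioi (0:ℝ), h y) := by
  have : Nonempty (Fin n) := ⟨⟨0, hn⟩⟩
  have hi : IntegrableOn (fun y : ℝ ↦ y ^ (n - 1) • f y) (Ioi 0) :=
    hh.congr_fun (fun y hy => (hfh y hy).symm) measurableSet_Ioi
  have hI : Integrable (fun x : EuclideanSpace ℝ (Fin n) => f ‖x‖) volume := by
    rw [integrable_fun_norm_addHaar volume (f := f)]
    simpa using hi
  rw [← ofReal_integral_eq_lintegral_ofReal hI (Filter.Eventually.of_forall fun x => hf _ (norm_nonneg _)),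
    integral_fun_norm_addHaar volume f]
  congr 1
  simp only [finrank_euclideanSpace, Fintype.card_fin, nsmul_eq_mul, smul_eq_mul, sphC]
  rw [setIntegral_congr_fun measurableSet_Ioi hfh, mul_assoc]

lemma pow_mul_rpow_aux (n : ℕ) (hn : 1 ≤ n) (y a : ℝ) (hy : 0 < y) :
    y ^ (n - 1) * y ^ (a - n) = y ^ (a - 1) := by
  rw [← Real.rpow_natCast, ← Real.rpow_add hy]
  congr 1
  push_cast [hn]; ring

lemma near_lintegral (n : ℕ) (hn : 1 ≤ n) (a d : ℝ) (ha : 0 < a) (hd : 0 < d) :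
    ∫⁻ x : EuclideanSpace ℝ (Fin n), ENNReal.ofReal (if ‖x‖ < d then ‖x‖ ^ (a - n) else 0) =
      ENNReal.ofReal (sphC n * (d ^ a / a)) := by
  have hint : IntegrableOn (fun y : ℝ => y ^ (a - 1)) (Ioo 0 d) :=
    (intervalIntegral.integrableOn_Ioo_rpow_iff hd).2 (by linarith)
  rw [radial_lintegral n hn (fun r => if r < d then r ^ (a - n) else 0) _
    ((Iio d).indicator fun y => y ^ (a - 1))]
  · congr 2
    rw [setIntegral_indicator measurableSet_Iio, Ioi_inter_Iio, ← integral_Ioc_eq_integral_Ioo,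
      ← intervalIntegral.integral_of_le hd.le, integral_rpow (Or.inl (by linarith))]
    simp [Real.zero_rpow ha.ne']
  · intro y hy
    by_cases h : y < d
    · simp [h, pow_mul_rpow_aux n hn y a hy]
    · simp [h]
  · rw [IntegrableOn, integrable_indicator_iff measurableSet_Iio, IntegrableOn,
      Measure.restrict_restrict measurableSet_Iio, inter_comm, Ioi_inter_Iio]
    exact hint
  · intro r hr; split_ifs <;> positivity

lemma far_lintegral (n : ℕ) (hn : 1 ≤ n) (b d : ℝ) (hb : 0 < b) (hd : 0 < d) :
    ∫⁻ x : EuclideanSpace ℝ (Fin n), ENNReal.ofReal (if d ≤ ‖x‖ then ‖x‖ ^ (-b - n) else 0) =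
      ENNReal.ofReal (sphC n * (d ^ (-b) / b)) := by
  have hsub : Ioi 0 ∩ Ici d = Ici d := inter_eq_right.2 fun x hx => hd.trans_le hx
  rw [radial_lintegral n hn (fun r => if d ≤ r then r ^ (-b - n) else 0) _
    ((Ici d).indicator fun y => y ^ (-b - 1))]
  · congr 2
    rw [setIntegral_indicator measurableSet_Ici, hsub, integral_Ici_eq_integral_Ioi,
      integral_Ioi_rpow_of_lt (by linarith) hd]
    simp [neg_div_neg_eq]
  · intro y hy
    by_cases h : d ≤ y
    · simp [h, pow_mul_rpow_aux n hn y (-b) hy]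
    · simp [h]
  · rw [IntegrableOn, integrable_indicator_iff measurableSet_Ici, IntegrableOn,
      Measure.restrict_restrict measurableSet_Ici, inter_comm, hsub]
    exact (integrableOn_Ici_iff_integrableOn_Ioi (by simp)).2 (integrableOn_Ioi_rpow_of_lt (by linarith) hd)
  · intro r hr; split_ifs <;> positivity

lemma geom_facts (n : ℕ) (hn : 1 ≤ n) (Ω : Set (EuclideanSpace ℝ (Fin n))) (ho : IsOpen Ω)
    (hb : Bornology.IsBounded Ω) (hne : Ω.Nonempty) (x) (hx : x ∈ Ω) :
    0 < infDist x (frontier Ω) ∧ infDist x (frontier Ω) ≤ diam Ω ∧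
      ∀ y ∈ Ωᶜ, infDist x (frontier Ω) ≤ ‖x - y‖ := by
  have : Nonempty (Fin n) := ⟨⟨0, hn⟩⟩
  have hu : Ω ≠ univ := fun h => NormedSpace.unbounded_univ ℝ (EuclideanSpace ℝ (Fin n)) (h ▸ hb)
  have hf : (frontier Ω).Nonempty := nonempty_frontier_iff.2 ⟨hne, hu⟩
  refine ⟨?_, ?_, ?_⟩
  · rw [← isClosed_frontier.notMem_iff_infDist_pos hf]
    intro h
    rw [ho.frontier_eq] at h
    exact h.2 hx
  · obtain ⟨z, hz⟩ := hf
    refine (infDist_le_dist_of_mem hz).trans ?_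
    rw [← diam_closure]
    exact dist_le_diam_of_mem hb.closure (subset_closure hx) (frontier_subset_closure hz)
  · intro y hy
    obtain ⟨z, hz, h⟩ := exists_mem_frontier_infDist_compl_eq_dist hx hu
    rw [← dist_eq_norm]
    calc _ ≤ dist x z := infDist_le_dist_of_mem hz
      _ = infDist x Ωᶜ := h.symm
      _ ≤ _ := infDist_le_dist_of_mem hy

/-- Majorant of the interior kernel. -/
noncomputable def majB (n : ℕ) (s ε K p r : ℝ) : ℝ :=
  K ^ 2 * p ^ (-1 - 2 * ε) * (if r < p then r ^ (4 * ε - n) else 0) +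
  4 * K ^ 2 * p ^ (2 * s - 1 - 2 * ε) * (if p ≤ r then r ^ (-(2 * s - 4 * ε) - n) else 0)

lemma majB_nonneg (n : ℕ) (s ε K p r : ℝ) (hp : 0 ≤ p) (hr : 0 ≤ r) : 0 ≤ majB n s ε K p r := by
  unfold majB; split_ifs <;> positivity

lemma majB_bound (n : ℕ) (s ε K p q r G : ℝ) (hs : s < 1) (hp : 0 < p) (hpq : p ≤ q) (hr : 0 < r)
    (hK : 0 ≤ K) (hG : 0 ≤ G)
    (h1 : G ≤ K * r ^ s / p) (h2 : G ≤ K * p ^ (s - 1) + K * q ^ (s - 1)) :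
    G ^ 2 * p ^ (1 - 2 * ε) * r ^ (-((n : ℝ) + 2 * s - 4 * ε)) ≤ majB n s ε K p r := by
  unfold majB
  by_cases h : r < p
  · simp only [h, if_true, not_le.2 h, if_false, mul_zero, add_zero]
    calc _ ≤ (K * r ^ s / p) ^ 2 * p ^ (1 - 2 * ε) * r ^ (-((n : ℝ) + 2 * s - 4 * ε)) := by gcongr
      _ = K ^ 2 * (p ^ (-2 : ℝ) * p ^ (1 - 2 * ε)) *
          (r ^ (s * 2) * r ^ (-((n : ℝ) + 2 * s - 4 * ε))) := by
        rw [Real.rpow_mul hr.le, Real.rpow_neg hp.le]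
        norm_cast
        field_simp
      _ = _ := by
        rw [← Real.rpow_add hp, ← Real.rpow_add hr]
        ring_nf
  · simp only [h, if_false, not_lt.1 h, if_true, mul_zero, zero_add]
    have h3 : q ^ (s - 1) ≤ p ^ (s - 1) := Real.rpow_le_rpow_of_nonpos hp hpq (by linarith)
    have h4 : G ≤ 2 * K * p ^ (s - 1) := by nlinarith
    calc _ ≤ (2 * K * p ^ (s - 1)) ^ 2 * p ^ (1 - 2 * ε) * r ^ (-((n : ℝ) + 2 * s - 4 * ε)) := by
            gcongr
      _ = 4 * K ^ 2 * (p ^ ((s - 1) * 2) * p ^ (1 - 2 * ε)) *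
          r ^ (-((n : ℝ) + 2 * s - 4 * ε)) := by
        rw [Real.rpow_mul hp.le]
        norm_cast
        ring
      _ = _ := by
        rw [← Real.rpow_add hp]
        ring_nf

lemma majB_meas (n : ℕ) (s ε K : ℝ) : Measurable fun z : ℝ × ℝ => majB n s ε K z.1 z.2 := by
  unfold majB
  refine Measurable.add (Measurable.mul (by fun_prop) ?_) (Measurable.mul (by fun_prop) ?_)
  · exact Measurable.ite (measurableSet_lt measurable_snd measurable_fst) (by fun_prop) (by fun_prop)
  · exact Measurable.ite (measurableSet_le measurable_fst measurable_snd) (by fun_prop) (by fun_prop)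

lemma majB_lintegral (n : ℕ) (hn : 1 ≤ n) (s ε K p : ℝ) (hp : 0 < p) (hε : 0 < ε) (hs : 2 * ε < s)
    (x : EuclideanSpace ℝ (Fin n)) :
    ∫⁻ y, ENNReal.ofReal (majB n s ε K p ‖x - y‖) =
      ENNReal.ofReal ((sphC n * (K ^ 2 / (4 * ε) + 4 * K ^ 2 / (2 * s - 4 * ε))) *
        p ^ (2 * ε - 1)) := by
  have hc := sphC_nonneg n
  have hb : 0 < 2 * s - 4 * ε := by linarith
  rw [lintegral_sub_left_eq_self (fun y => ENNReal.ofReal (majB n s ε K p ‖y‖)) x]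
  have e : ∀ y : EuclideanSpace ℝ (Fin n), ENNReal.ofReal (majB n s ε K p ‖y‖) =
      ENNReal.ofReal (K ^ 2 * p ^ (-1 - 2 * ε)) *
        ENNReal.ofReal (if ‖y‖ < p then ‖y‖ ^ (4 * ε - n) else 0) +
      ENNReal.ofReal (4 * K ^ 2 * p ^ (2 * s - 1 - 2 * ε)) *
        ENNReal.ofReal (if p ≤ ‖y‖ then ‖y‖ ^ (-(2 * s - 4 * ε) - n) else 0) := by
    intro y
    unfold majB
    rw [ENNReal.ofReal_add (by split_ifs <;> positivity) (by split_ifs <;> positivity),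
      ENNReal.ofReal_mul (p := K ^ 2 * p ^ (-1 - 2 * ε)) (by positivity),
      ENNReal.ofReal_mul (p := 4 * K ^ 2 * p ^ (2 * s - 1 - 2 * ε)) (by positivity)]
  have m1 : Measurable fun y : EuclideanSpace ℝ (Fin n) =>
      ENNReal.ofReal (if ‖y‖ < p then ‖y‖ ^ (4 * ε - n) else 0) :=
    (Measurable.ite (measurableSet_lt (by fun_prop) (by fun_prop))
      (by fun_prop) (by fun_prop)).ennreal_ofReal
  have m2 : Measurable fun y : EuclideanSpace ℝ (Fin n) =>
      ENNReal.ofReal (if p ≤ ‖y‖ then ‖y‖ ^ (-(2 * s - 4 * ε) - n) else 0) :=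
    (Measurable.ite (measurableSet_le (by fun_prop) (by fun_prop))
      (by fun_prop) (by fun_prop)).ennreal_ofReal
  simp_rw [e]
  rw [lintegral_add_left (m1.const_mul _), lintegral_const_mul _ m1, lintegral_const_mul _ m2,
    near_lintegral n hn _ p (by linarith) hp, far_lintegral n hn _ p hb hp,
    ← ENNReal.ofReal_mul (by positivity), ← ENNReal.ofReal_mul (by positivity),
    ← ENNReal.ofReal_add (by positivity) (by positivity)]
  congr 1
  have e1 : p ^ (-1 - 2 * ε) * p ^ (4 * ε) = p ^ (2 * ε - 1) := by
    rw [← Real.rpow_add hp]; ring_nf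
  have e2 : p ^ (2 * s - 1 - 2 * ε) * p ^ (-(2 * s - 4 * ε)) = p ^ (2 * ε - 1) := by
    rw [← Real.rpow_add hp]; ring_nf
  linear_combination (sphC n * K ^ 2 / (4 * ε)) * e1 +
    (sphC n * (4 * K ^ 2) / (2 * s - 4 * ε)) * e2

theorem stmt1 (n : ℕ) (hn : 1 ≤ n) :
    ∃ C : ℝ, 0 < C ∧
      ∀ (Ω : Set (EuclideanSpace ℝ (Fin n))), IsOpen Ω → Bornology.IsBounded Ω → Ω.Nonempty →
      ∀ (s ε K : ℝ), s ∈ Set.Ioo (0:ℝ) 1 → ε ∈ Set.Ioo 0 (s / 2) → 0 ≤ K →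
      ∀ (g : EuclideanSpace ℝ (Fin n) → EuclideanSpace ℝ (Fin n)), Measurable g →
      (∀ x ∈ Ω, ‖g x‖ ≤ K * Metric.infDist x (frontier Ω) ^ (s - 1)) →
      (∀ x ∈ Ω, ∀ y ∈ Ω, ‖g x - g y‖ ≤
        K * ‖x - y‖ ^ s / min (Metric.infDist x (frontier Ω)) (Metric.infDist y (frontier Ω))) →
      MeasureTheory.IntegrableOn
        (fun x => Metric.infDist x (frontier Ω) ^ (2 * ε - 1)) Ω volume →
      (∫⁻ x in Ω, ENNReal.ofReal
          (‖g x‖ ^ 2 * Metric.infDist x (frontier Ω) ^ (1 - 2 * ε))) +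
      (∫⁻ x in Ω, ∫⁻ y in Ω, ENNReal.ofReal (‖g x - g y‖ ^ 2 *
          (min (Metric.infDist x (frontier Ω)) (Metric.infDist y (frontier Ω))) ^ (1 - 2 * ε) *
          ‖x - y‖ ^ (-((n : ℝ) + 2 * s - 4 * ε)))) +
      (∫⁻ x in Ω, ENNReal.ofReal (‖g x‖ ^ 2) *
        ∫⁻ y in Ωᶜ, ENNReal.ofReal
          ((min (Metric.infDist x (frontier Ω)) (Metric.infDist y (frontier Ω))) ^ (1 - 2 * ε) *
          ‖x - y‖ ^ (-((n : ℝ) + 2 * s - 4 * ε)))) ≤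
      ENNReal.ofReal (C * (1 + Metric.diam Ω) ^ 2 * K ^ 2 *
        (∫ x in Ω, Metric.infDist x (frontier Ω) ^ (2 * ε - 1)) * (1 / ε + 1 / (s - 2 * ε))) := by
  have hc := sphC_nonneg n
  refine ⟨1 + 5 * sphC n, by positivity, ?_⟩
  rintro Ω ho hbd hne s ε K ⟨hs0, hs1⟩ ⟨hε, hεs⟩ hK g hg hg1 hg2 hA
  have hgeo := geom_facts n hn Ω ho hbd hne
  have hδ0 : ∀ x : EuclideanSpace ℝ (Fin n), 0 ≤ infDist x (frontier Ω) := fun x => infDist_nonneg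
  set δ : EuclideanSpace ℝ (Fin n) → ℝ := fun x => infDist x (frontier Ω) with hδ
  have hmδ : Measurable δ := (continuous_infDist_pt _).measurable
  have hmΩ : MeasurableSet Ω := ho.measurableSet
  have hsε : 0 < s - 2 * ε := by linarith
  have hb : 0 < 2 * s - 4 * ε := by linarith
  set A := ∫ x in Ω, δ x ^ (2 * ε - 1) with hAdef
  have hA0 : 0 ≤ A := integral_nonneg fun x => Real.rpow_nonneg (hδ0 x) _
  have hD : 0 ≤ diam Ω := diam_nonneg
  have hAint : ∀ c : ℝ, 0 ≤ c →
      ∫⁻ x in Ω, ENNReal.ofReal (c * δ x ^ (2 * ε - 1)) = ENNReal.ofReal (c * A) := by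
    intro c hc0
    rw [hAdef, ← integral_const_mul, ofReal_integral_eq_lintegral_ofReal (hA.const_mul c)]
    exact Filter.Eventually.of_forall fun x => mul_nonneg hc0 (Real.rpow_nonneg (hδ0 x) _)
  have hgsq : ∀ x ∈ Ω, ‖g x‖ ^ 2 ≤ K ^ 2 * δ x ^ (2 * s - 2) := by
    intro x hx
    calc ‖g x‖ ^ 2 ≤ (K * δ x ^ (s - 1)) ^ 2 := by gcongr; exact hg1 x hx
      _ = K ^ 2 * δ x ^ ((s - 1) * 2) := by
        rw [Real.rpow_mul (hδ0 x)]; norm_cast; ring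
      _ = _ := by ring_nf
  -- term 1
  have T1 : (∫⁻ x in Ω, ENNReal.ofReal (‖g x‖ ^ 2 * δ x ^ (1 - 2 * ε))) ≤
      ENNReal.ofReal ((K ^ 2 * (1 + diam Ω) ^ 2) * A) := by
    rw [← hAint _ (by positivity)]
    refine setLIntegral_mono' hmΩ fun x hx => ENNReal.ofReal_le_ofReal ?_
    obtain ⟨hp, hpD, -⟩ := hgeo x hx
    change 0 < δ x at hp
    change δ x ≤ _ at hpD
    have h1 : δ x ^ (2 * s - 4 * ε) ≤ (1 + diam Ω) ^ 2 := by
      calc δ x ^ (2 * s - 4 * ε) ≤ (1 + diam Ω) ^ (2 * s - 4 * ε) :=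
            Real.rpow_le_rpow hp.le (by linarith) hb.le
        _ ≤ (1 + diam Ω) ^ (2 : ℝ) :=
            Real.rpow_le_rpow_of_exponent_le (by linarith) (by linarith)
        _ = _ := by norm_cast
    calc ‖g x‖ ^ 2 * δ x ^ (1 - 2 * ε) ≤ K ^ 2 * δ x ^ (2 * s - 2) * δ x ^ (1 - 2 * ε) := by
          gcongr; exact hgsq x hx
      _ = K ^ 2 * δ x ^ (2 * s - 4 * ε) * δ x ^ (2 * ε - 1) := by
          rw [mul_assoc, mul_assoc, ← Real.rpow_add hp, ← Real.rpow_add hp]; ring_nf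
      _ ≤ _ := by gcongr
  -- term 3
  have T3 : (∫⁻ x in Ω, ENNReal.ofReal (‖g x‖ ^ 2) *
        ∫⁻ y in Ωᶜ, ENNReal.ofReal ((min (δ x) (δ y)) ^ (1 - 2 * ε) *
          ‖x - y‖ ^ (-((n : ℝ) + 2 * s - 4 * ε)))) ≤
      ENNReal.ofReal ((K ^ 2 * sphC n / (2 * s - 4 * ε)) * A) := by
    rw [← hAint _ (by positivity)]
    refine setLIntegral_mono' hmΩ fun x hx => ?_
    obtain ⟨hp, -, hpy⟩ := hgeo x hx
    change 0 < δ x at hp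
    have m2 : Measurable fun y : EuclideanSpace ℝ (Fin n) =>
        ENNReal.ofReal (if δ x ≤ ‖x - y‖ then ‖x - y‖ ^ (-(2 * s - 4 * ε) - n) else 0) :=
      (Measurable.ite (measurableSet_le (by fun_prop) (by fun_prop))
        (by fun_prop) (by fun_prop)).ennreal_ofReal
    have hin : ∫⁻ y in Ωᶜ, ENNReal.ofReal ((min (δ x) (δ y)) ^ (1 - 2 * ε) *
          ‖x - y‖ ^ (-((n : ℝ) + 2 * s - 4 * ε))) ≤
        ENNReal.ofReal (δ x ^ (1 - 2 * ε)) *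
          ENNReal.ofReal (sphC n * (δ x ^ (-(2 * s - 4 * ε)) / (2 * s - 4 * ε))) := by
      rw [← far_lintegral n hn _ _ hb hp, 
        ← lintegral_sub_left_eq_self (fun y : EuclideanSpace ℝ (Fin n) =>
          ENNReal.ofReal (if δ x ≤ ‖y‖ then ‖y‖ ^ (-(2 * s - 4 * ε) - n) else 0)) x,
        ← lintegral_const_mul _ m2]
      refine le_trans (setLIntegral_mono' hmΩ.compl fun y hy => ?_) (setLIntegral_le_lintegral _ _)
      rw [← ENNReal.ofReal_mul (by positivity), if_pos (hpy y hy)]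
      refine ENNReal.ofReal_le_ofReal ?_
      rw [show -((n : ℝ) + 2 * s - 4 * ε) = -(2 * s - 4 * ε) - n by ring]
      gcongr ?_ * _
      exact Real.rpow_le_rpow (le_min hp.le (hδ0 y)) (min_le_left _ _) (by linarith)
    refine (mul_le_mul' (ENNReal.ofReal_le_ofReal (hgsq x hx)) hin).trans (le_of_eq ?_)
    rw [← ENNReal.ofReal_mul (by positivity), ← ENNReal.ofReal_mul (by positivity)]
    congr 1
    have e2 : δ x ^ (2 * s - 2) * (δ x ^ (1 - 2 * ε) * δ x ^ (-(2 * s - 4 * ε)))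
        = δ x ^ (2 * ε - 1) := by
      rw [← Real.rpow_add hp, ← Real.rpow_add hp]; ring_nf
    linear_combination (K ^ 2 * sphC n / (2 * s - 4 * ε)) * e2
  -- term 2
  set M := sphC n * (K ^ 2 / (4 * ε) + 4 * K ^ 2 / (2 * s - 4 * ε)) with hM
  have hM0 : 0 ≤ M := by positivity
  have T2 : (∫⁻ x in Ω, ∫⁻ y in Ω, ENNReal.ofReal (‖g x - g y‖ ^ 2 *
          (min (δ x) (δ y)) ^ (1 - 2 * ε) * ‖x - y‖ ^ (-((n : ℝ) + 2 * s - 4 * ε)))) ≤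
      ENNReal.ofReal (M * A) + ENNReal.ofReal (M * A) := by
    have hmB : Measurable fun z : EuclideanSpace ℝ (Fin n) × EuclideanSpace ℝ (Fin n) =>
        ENNReal.ofReal (majB n s ε K (δ z.1) ‖z.1 - z.2‖) :=
      ((majB_meas n s ε K).comp ((hmδ.comp measurable_fst).prodMk
        (measurable_fst.sub measurable_snd).norm)).ennreal_ofReal
    have hH : ∫⁻ x in Ω, ∫⁻ y in Ω, ENNReal.ofReal (majB n s ε K (δ x) ‖x - y‖) ≤
        ENNReal.ofReal (M * A) := by
      rw [← hAint _ hM0]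
      refine setLIntegral_mono' hmΩ fun x hx => ?_
      rw [hM, ← majB_lintegral n hn s ε K (δ x) (hgeo x hx).1 hε (by linarith) x]
      exact setLIntegral_le_lintegral _ _
    have hpt : ∀ x ∈ Ω, ∀ y ∈ Ω, ENNReal.ofReal (‖g x - g y‖ ^ 2 *
          (min (δ x) (δ y)) ^ (1 - 2 * ε) * ‖x - y‖ ^ (-((n : ℝ) + 2 * s - 4 * ε))) ≤
        ENNReal.ofReal (majB n s ε K (δ x) ‖x - y‖) +
          ENNReal.ofReal (majB n s ε K (δ y) ‖y - x‖) := by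
      intro x hx y hy
      by_cases hxy : x = y
      · subst hxy; simp
      have hr : 0 < ‖x - y‖ := norm_pos_iff.2 (sub_ne_zero.2 hxy)
      have h1 := hg2 x hx y hy
      have h2 : ‖g x - g y‖ ≤ K * δ x ^ (s - 1) + K * δ y ^ (s - 1) :=
        (norm_sub_le _ _).trans (add_le_add (hg1 x hx) (hg1 y hy))
      change _ ≤ K * ‖x - y‖ ^ s / min (δ x) (δ y) at h1
      rcases le_total (δ x) (δ y) with h | h
      · rw [min_eq_left h] at h1 ⊢
        exact le_add_right (ENNReal.ofReal_le_ofReal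
          (majB_bound n s ε K _ _ _ _ hs1 (hgeo x hx).1 h hr hK (norm_nonneg _) h1 h2))
      · rw [min_eq_right h] at h1 ⊢
        rw [norm_sub_rev y x]
        exact le_add_left (ENNReal.ofReal_le_ofReal
          (majB_bound n s ε K _ _ _ _ hs1 (hgeo y hy).1 h hr hK (norm_nonneg _) h1
            (by linarith)))
    calc _ ≤ ∫⁻ x in Ω, ∫⁻ y in Ω, (ENNReal.ofReal (majB n s ε K (δ x) ‖x - y‖) +
          ENNReal.ofReal (majB n s ε K (δ y) ‖y - x‖)) :=
          setLIntegral_mono' hmΩ fun x hx => setLIntegral_mono' hmΩ fun y hy => hpt x hx y hy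
      _ = (∫⁻ x in Ω, ∫⁻ y in Ω, ENNReal.ofReal (majB n s ε K (δ x) ‖x - y‖)) +
          ∫⁻ x in Ω, ∫⁻ y in Ω, ENNReal.ofReal (majB n s ε K (δ y) ‖y - x‖) := by
          rw [← lintegral_add_left (hmB.lintegral_prod_right')]
          refine lintegral_congr fun x => ?_
          exact lintegral_add_left (hmB.comp measurable_prodMk_left) _
      _ ≤ _ := by
          refine add_le_add hH ?_
          rw [lintegral_lintegral_swap
            (f := fun x y => ENNReal.ofReal (majB n s ε K (δ y) ‖y - x‖))
            (hmB.comp measurable_swap).aemeasurable]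
          exact hH
  refine (add_le_add (add_le_add T1 T2) T3).trans ?_
  rw [← ENNReal.ofReal_add (by positivity) (by positivity),
    ← ENNReal.ofReal_add (by positivity) (by positivity),
    ← ENNReal.ofReal_add (by positivity) (by positivity)]
  refine ENNReal.ofReal_le_ofReal ?_
  have hE : 1 ≤ 1 / ε := by rw [le_div_iff₀ hε]; linarith
  have hS : 0 ≤ 1 / (s - 2 * ε) := by positivity
  have hP : 1 ≤ (1 + diam Ω) ^ 2 := by nlinarith
  set P := (1 + diam Ω) ^ 2
  set E := 1 / ε with hEdef
  set S := 1 / (s - 2 * ε) with hSdef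
  have e1 : K ^ 2 / (4 * ε) = K ^ 2 * E / 4 := by rw [hEdef]; field_simp
  have e2 : 4 * K ^ 2 / (2 * s - 4 * ε) = 2 * K ^ 2 * S := by
    rw [hSdef, show 2 * s - 4 * ε = 2 * (s - 2 * ε) by ring]; field_simp; ring
  have e3 : K ^ 2 * sphC n / (2 * s - 4 * ε) = K ^ 2 * sphC n * S / 2 := by
    rw [hSdef, show 2 * s - 4 * ε = 2 * (s - 2 * ε) by ring]; field_simp
  rw [hM, e1, e2, e3]
  have hKA : 0 ≤ K ^ 2 * A := by positivity
  have f1 : P * 1 ≤ P * (E + S) := by gcongr; linarith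
  have f2 : sphC n * (E / 2 + 9 / 2 * S) ≤ 5 * sphC n * (P * (E + S)) := by
    have : 1 * (E + S) ≤ P * (E + S) := by gcongr
    have : E / 2 + 9 / 2 * S ≤ 5 * (P * (E + S)) := by linarith
    nlinarith
  have := mul_le_mul_of_nonneg_left (add_le_add f1 f2) hKA
  linarith
end

section
/- Let n ≥ 1, let Ω ⊂ ℝⁿ be a nonempty bounded open set, let s ∈ (0,1) and ε ∈ (0, s/2), and let G : Ω → [0, ∞] be measurable. Then ∫_Ω G(x) ( ∫_{Ωᶜ} δ(x,y)^{1−2ε} ‖x − y‖^{−(n+2s−4ε)} dy ) dx ≤ (ω_{n−1} / (2(s − 2ε))) · ∫_Ω G(x) δ(x)^{1−2s+2ε} dx. -/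
open MeasureTheory Metric Set

theorem radial_aux (n : ℕ) (hn : 1 ≤ n) (d t : ℝ) (hd : 0 < d) (ht : 0 < t) :
    ∫⁻ z : EuclideanSpace ℝ (Fin n),
      ENNReal.ofReal ((Ici d).indicator (fun r : ℝ => r ^ (-((n : ℝ) + t))) ‖z‖) =
    ENNReal.ofReal ((n * (volume (Metric.ball (0 : EuclideanSpace ℝ (Fin n)) 1)).toReal) *
      (d ^ (-t) / t)) := by
  have : Nonempty (Fin n) := ⟨⟨0, hn⟩⟩
  have hfr : Module.finrank ℝ (EuclideanSpace ℝ (Fin n)) = n := by simp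
  set f : ℝ → ℝ := (Ici d).indicator (fun r : ℝ => r ^ (-((n : ℝ) + t))) with hf
  have heq : (fun y : ℝ => y ^ (n - 1) • f y) =
      (Ici d).indicator (fun r : ℝ => r ^ (-t - 1)) := by
    funext y
    by_cases hy : d ≤ y
    · have hy0 : 0 < y := hd.trans_le hy
      simp only [hf, smul_eq_mul, indicator_of_mem (mem_Ici.2 hy)]
      rw [← Real.rpow_natCast, ← Real.rpow_add hy0, Nat.cast_sub hn]
      congr 1
      push_cast
      ring
    · simp [hf, hy]
  have hsub : Ici d ∩ Ioi (0 : ℝ) = Ici d :=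
    inter_eq_left.2 fun y hy => hd.trans_le (mem_Ici.1 hy)
  have hint : Integrable (fun z : EuclideanSpace ℝ (Fin n) => f ‖z‖) := by
    rw [integrable_fun_norm_addHaar, hfr, heq, IntegrableOn,
      integrable_indicator_iff measurableSet_Ici, IntegrableOn,
      Measure.restrict_restrict measurableSet_Ici, hsub]
    change IntegrableOn (fun r : ℝ => r ^ (-t - 1)) (Ici d) volume
    rw [integrableOn_Ici_iff_integrableOn_Ioi]
    exact integrableOn_Ioi_rpow_of_lt (by linarith) hd
  rw [← ofReal_integral_eq_lintegral_ofReal hint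
    (Filter.Eventually.of_forall fun z => indicator_nonneg
      (fun r hr => Real.rpow_nonneg (hd.le.trans (mem_Ici.1 hr)) _) _)]
  rw [integral_fun_norm_addHaar, hfr, heq, integral_indicator measurableSet_Ici,
    Measure.restrict_restrict measurableSet_Ici, hsub, integral_Ici_eq_integral_Ioi,
    integral_Ioi_rpow_of_lt (by linarith) hd]
  congr 1
  simp only [nsmul_eq_mul, smul_eq_mul, Measure.real, sub_add_cancel, neg_div_neg_eq]
  ring

/-- **Bound for the exterior term 𝓘_𝒪 (proof of Theorem 2.4).**
For a nonempty bounded open `Ω ⊂ ℝⁿ`, `s ∈ (0,1)`, `ε ∈ (0, s/2)` and measurable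
`G : Ω → [0,∞]`,
`∫_Ω G(x) (∫_{Ωᶜ} δ(x,y)^{1−2ε} ‖x−y‖^{−(n+2s−4ε)} dy) dx
  ≤ (ω_{n−1}/(2(s−2ε))) ∫_Ω G(x) δ(x)^{1−2s+2ε} dx`,
where `δ(z) = dist(z, ∂Ω)`, `δ(x,y) = min(δ(x), δ(y))`, and `ω_{n−1} = n·vol(B₁)` is the
surface measure of the unit sphere. -/
theorem stmt2 (n : ℕ) (hn : 1 ≤ n)
    (Ω : Set (EuclideanSpace ℝ (Fin n))) (hΩo : IsOpen Ω) (hΩb : Bornology.IsBounded Ω)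
    (hΩne : Ω.Nonempty) (s ε : ℝ) (hs : s ∈ Set.Ioo (0:ℝ) 1) (hε : ε ∈ Set.Ioo 0 (s / 2))
    (G : EuclideanSpace ℝ (Fin n) → ENNReal) (hG : Measurable G) :
    (∫⁻ x in Ω, G x *
        ∫⁻ y in Ωᶜ, ENNReal.ofReal
          ((min (Metric.infDist x (frontier Ω)) (Metric.infDist y (frontier Ω))) ^ (1 - 2 * ε) *
            ‖x - y‖ ^ (-((n : ℝ) + 2 * s - 4 * ε)))) ≤
      ENNReal.ofReal
          ((n * (volume (Metric.ball (0 : EuclideanSpace ℝ (Fin n)) 1)).toReal) /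
            (2 * (s - 2 * ε))) *
        ∫⁻ x in Ω, G x *
          ENNReal.ofReal (Metric.infDist x (frontier Ω) ^ (1 - 2 * s + 2 * ε)) := by
  obtain ⟨hs0, hs1⟩ := hs
  obtain ⟨hε0, hε1⟩ := hε
  have : Nonempty (Fin n) := ⟨⟨0, hn⟩⟩
  have hΩu : Ω ≠ univ := by
    rintro rfl
    exact NormedSpace.unbounded_univ ℝ (EuclideanSpace ℝ (Fin n)) hΩb
  have hfne : (frontier Ω).Nonempty := nonempty_frontier_iff.2 ⟨hΩne, hΩu⟩
  rw [← lintegral_const_mul' _ _ ENNReal.ofReal_ne_top]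
  refine setLIntegral_mono' hΩo.measurableSet fun x hx => ?_
  rw [mul_left_comm]
  refine mul_le_mul_right ?_ _
  set d := Metric.infDist x (frontier Ω) with hdd
  have hd : 0 < d := by
    refine (isClosed_frontier.notMem_iff_infDist_pos hfne).1 fun h => ?_
    rw [hΩo.frontier_eq] at h
    exact h.2 hx
  have hdist : ∀ y ∈ Ωᶜ, d ≤ ‖x - y‖ := by
    intro y hy
    obtain ⟨w, hw, hw'⟩ := exists_mem_frontier_infDist_compl_eq_dist hx hΩu
    rw [← dist_eq_norm]
    exact (Metric.infDist_le_dist_of_mem hw).trans (hw' ▸ Metric.infDist_le_dist_of_mem hy)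
  have ht : 0 < 2 * s - 4 * ε := by linarith
  set f : ℝ → ℝ := (Ici d).indicator (fun r : ℝ => r ^ (-((n : ℝ) + (2 * s - 4 * ε)))) with hf
  calc
    _ ≤ ∫⁻ y in Ωᶜ, ENNReal.ofReal (d ^ (1 - 2 * ε)) * ENNReal.ofReal (f ‖x - y‖) := by
      refine setLIntegral_mono' hΩo.measurableSet.compl fun y hy => ?_
      rw [← ENNReal.ofReal_mul (by positivity), hf,
        indicator_of_mem (mem_Ici.2 (hdist y hy)), add_sub_assoc]
      refine ENNReal.ofReal_le_ofReal (mul_le_mul_of_nonneg_right ?_ (by positivity))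
      exact Real.rpow_le_rpow (le_min hd.le Metric.infDist_nonneg) (min_le_left _ _)
        (by linarith)
    _ ≤ ∫⁻ y, ENNReal.ofReal (d ^ (1 - 2 * ε)) * ENNReal.ofReal (f ‖x - y‖) :=
      setLIntegral_le_lintegral _ _
    _ = ENNReal.ofReal (d ^ (1 - 2 * ε)) * ∫⁻ z : EuclideanSpace ℝ (Fin n),
          ENNReal.ofReal (f ‖z‖) := by
      rw [lintegral_const_mul' _ _ ENNReal.ofReal_ne_top,
        lintegral_sub_left_eq_self (fun z => ENNReal.ofReal (f ‖z‖)) x]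
    _ = _ := by
      rw [hf, radial_aux n hn d _ hd ht, ← ENNReal.ofReal_mul (by positivity),
        ← ENNReal.ofReal_mul (div_nonneg (by positivity) (by linarith))]
      congr 1
      have h1 : d ^ (1 - 2 * s + 2 * ε) = d ^ (1 - 2 * ε) * d ^ (-(2 * s - 4 * ε)) := by
        rw [← Real.rpow_add hd]
        congr 1
        ring
      rw [h1, show 2 * (s - 2 * ε) = 2 * s - 4 * ε by ring]
      ring
end
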